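/- For all integers s ≥ 0, t ≥ 0 and ω' ≥ 2t+s, there exist polynomials Q_0, …, Q_s with real coefficients such that for all real z: Σ_{j=0}^{ω'} (-1)^j (2j+2t+1)! z^{j+1} / ((ω'-j)! (j+t-s)! (2j+2)!) = (2t)! (t-s)_s / (2 (ω'+1)! · t!) + Σ_{k=0}^{s} Q_k(z) · G_k(z), where G_k(z) = Σ_{m=0}^{ω'+1-k} [ (k-1-ω')_m (1/2+t+k)_m / (1/2+k)_m ] z^m / m! is the terminating hypergeometric sum ₂F₁(-1-ω'+k, 1/2+t+k; 1/2+k; z), (t-s)_s = (t-s)(t-s+1)⋯(t-1) with (x)_0 = 1, and a term with j+t-s < 0 is interpreted as 0. -/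

import Mathlib

open Finset

/-- The Pochhammer symbol `(a)_m = a(a+1)⋯(a+m-1)`. -/
noncomputable def poch (a : ℝ) (m : ℕ) : ℝ := ∏ i ∈ Finset.range m, (a + (i : ℝ))

theorem poch_add' (a : ℝ) (k n : ℕ) : poch a (k + n) = poch a k * poch (a + k) n := by
  unfold poch
  rw [Finset.prod_range_add]
  congr 1
  apply Finset.prod_congr rfl
  intro i _
  push_cast
  ring

theorem poch_succ' (a : ℝ) (k : ℕ) : poch a (k + 1) = poch a k * (a + k) := by
  unfold poch
  rw [Finset.prod_range_succ]

theorem poch_pos' (a : ℝ) (ha : 0 < a) (k : ℕ) : 0 < poch a k := by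
  unfold poch
  apply Finset.prod_pos
  intro i _
  positivity

theorem fact_two (n : ℕ) :
    ((2 * n).factorial : ℝ) = 4 ^ n * n.factorial * poch (1 / 2) n := by
  induction n with
  | zero => simp [poch]
  | succ n ih =>
    rw [show 2 * (n + 1) = (2 * n + 1) + 1 by ring, Nat.factorial_succ, Nat.factorial_succ,
      Nat.factorial_succ, poch_succ']
    push_cast
    rw [ih]
    ring

theorem poch_neg' (N m : ℕ) (h : m ≤ N) :
    poch (-(N : ℝ)) m * ((N - m).factorial : ℝ) = (-1) ^ m * N.factorial := by
  induction m with
  | zero => simp [poch]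
  | succ m ih =>
    have ih := ih (by omega)
    obtain ⟨d, rfl⟩ : ∃ d, N = m + 1 + d := ⟨N - (m + 1), by omega⟩
    rw [show m + 1 + d - m = d + 1 by omega, Nat.factorial_succ] at ih
    rw [show m + 1 + d - (m + 1) = d by omega, poch_succ', pow_succ]
    push_cast at ih ⊢
    linear_combination -ih

theorem fact_poch (d s : ℕ) :
    (d.factorial : ℝ) * poch ((d : ℝ) + 1) s = ((d + s).factorial : ℝ) := by
  induction s with
  | zero => simp [poch]
  | succ s ih =>
    rw [poch_succ', ← add_assoc, Nat.factorial_succ]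
    push_cast
    linear_combination ((d : ℝ) + 1 + s) * ih

theorem gamma_inv (n s : ℕ) :
    (Real.Gamma ((n : ℝ) - s + 1))⁻¹ = poch ((n : ℝ) + 1 - s) s / n.factorial := by
  rcases le_or_gt s n with h | h
  · obtain ⟨d, rfl⟩ := Nat.exists_eq_add_of_le' h
    have e : ((d + s : ℕ) : ℝ) - s + 1 = d + 1 := by push_cast; ring
    have e' : ((d + s : ℕ) : ℝ) + 1 - s = d + 1 := by push_cast; ring
    rw [e, e', Real.Gamma_nat_eq_factorial, ← fact_poch]
    have := poch_pos' ((d : ℝ) + 1) (by positivity) s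
    field_simp
  · obtain ⟨d, rfl⟩ : ∃ d, s = n + 1 + d := ⟨s - (n + 1), by omega⟩
    have e : (n : ℝ) - ((n + 1 + d : ℕ) : ℝ) + 1 = -(d : ℝ) := by push_cast; ring
    have e' : (n : ℝ) + 1 - ((n + 1 + d : ℕ) : ℝ) = -(d : ℝ) := by push_cast; ring
    rw [e, e', Real.Gamma_neg_nat_eq_zero]
    have : poch (-(d : ℝ)) (n + 1 + d) = 0 := by
      unfold poch
      apply Finset.prod_eq_zero (i := d) (by simp)
      ring
    rw [this]
    simp

theorem desc_step (m k : ℕ) :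
    ((m.descFactorial (k + 1) : ℕ) : ℝ) = ((m : ℝ) - k) * (m.descFactorial k : ℝ) := by
  rw [Nat.descFactorial_succ]
  rcases le_or_gt k m with h | h
  · push_cast [h]
    ring
  · simp [Nat.descFactorial_of_lt h]

theorem poch_desc (a : ℝ) (s : ℕ) : ∃ p : ℕ → ℝ, ∀ m : ℕ,
    poch ((m : ℝ) + a) s = ∑ k ∈ range (s + 1), p k * (m.descFactorial k : ℝ) := by
  induction s with
  | zero => exact ⟨fun _ => 1, fun m => by simp [poch]⟩
  | succ s ih =>
    obtain ⟨p, hp⟩ := ih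
    refine ⟨fun k => (if k = 0 then 0 else p (k - 1)) +
      (if k = s + 1 then 0 else p k * (k + a + s)), fun m => ?_⟩
    simp only [add_mul, Finset.sum_add_distrib]
    rw [Finset.sum_range_succ' _ (s + 1)]
    rw [Finset.sum_range_succ (fun k => (if k = s + 1 then 0 else p k * (k + a + s)) * _) (s + 1)]
    rw [poch_succ', hp, Finset.sum_mul]
    simp only [if_true, zero_mul, add_zero, ← Finset.sum_add_distrib]
    apply Finset.sum_congr rfl
    intro k hk
    rw [Finset.mem_range] at hk
    rw [if_neg (by omega), if_neg (by omega), desc_step, Nat.add_sub_cancel]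
    ring

theorem hyp_shift (a b c z : ℝ) (hc : 0 < c) (N k : ℕ) (hk : k ≤ N) :
    ∑ m ∈ range (N + 1), poch a m * poch b m / poch c m * z ^ m / (m.factorial : ℝ) *
      (m.descFactorial k : ℝ) =
    poch a k * poch b k / poch c k * z ^ k * ∑ m ∈ range (N - k + 1),
      poch (a + k) m * poch (b + k) m / poch (c + k) m * z ^ m / (m.factorial : ℝ) := by
  obtain ⟨d, rfl⟩ := Nat.exists_eq_add_of_le hk
  rw [add_assoc, Finset.sum_range_add, Finset.sum_eq_zero, zero_add, Nat.add_sub_cancel_left,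
    Finset.mul_sum]
  · apply Finset.sum_congr rfl
    intro m _
    rw [poch_add', poch_add', poch_add', pow_add]
    have h1 := (poch_pos' c hc k).ne'
    have h2 := (poch_pos' (c + k) (by positivity) m).ne'
    have h3 := Nat.factorial_mul_descFactorial (show k ≤ k + m by omega)
    rw [Nat.add_sub_cancel_left] at h3
    have h4 : (m.factorial : ℝ) ≠ 0 := by positivity
    have h5 : ((k + m).factorial : ℝ) ≠ 0 := by positivity
    have h6 : ((k + m).descFactorial k : ℝ) = ((k + m).factorial : ℝ) / m.factorial := by
      rw [eq_div_iff h4, ← h3]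
      push_cast
      ring
    rw [h6]
    field_simp
  · intro m hm
    rw [Finset.mem_range] at hm
    simp [Nat.descFactorial_of_lt hm]

theorem coef_eq (s t N j : ℕ) (z : ℝ) (h : j + 1 ≤ N) :
    ((-1 : ℝ) ^ j * (Nat.factorial (2 * j + 2 * t + 1) : ℝ) * z ^ (j + 1) /
          ((Nat.factorial (N - (j + 1)) : ℝ) *
            Real.Gamma ((j : ℝ) + (t : ℝ) - (s : ℝ) + 1) * Nat.factorial (2 * j + 2))) =
    (-(1 / 2) * 4 ^ t * poch (1 / 2) t / N.factorial) *
      (poch (-(N : ℝ)) (j + 1) * poch (1 / 2 + (t : ℝ)) (j + 1) / poch (1 / 2) (j + 1) *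
        z ^ (j + 1) / ((j + 1).factorial : ℝ) *
        poch (((j + 1 : ℕ) : ℝ) + ((t : ℝ) - s)) s) := by
  have hg := gamma_inv (j + t) s
  have h1 := poch_neg' N (j + 1) h
  have h2 := fact_two (j + 1)
  have h3 := fact_two (t + (j + 1))
  rw [poch_add', show 2 * (t + (j + 1)) = (2 * j + 2 * t + 1) + 1 by ring,
    show t + (j + 1) = (j + t) + 1 by ring, Nat.factorial_succ (2 * j + 2 * t + 1),
    Nat.factorial_succ (j + t)] at h3
  have hp := poch_pos' (1 / 2) (by norm_num) (j + 1)
  have hf : ((N - (j + 1)).factorial : ℝ) ≠ 0 := by positivity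
  have hN : (N.factorial : ℝ) ≠ 0 := by positivity
  have hj : ((j + t).factorial : ℝ) ≠ 0 := by positivity
  have hj1 : ((j + 1).factorial : ℝ) ≠ 0 := by positivity
  have hjt : ((j : ℝ) + t + 1) ≠ 0 := by positivity
  have h1' : poch (-(N : ℝ)) (j + 1) = (-1) ^ (j + 1) * N.factorial / (N - (j + 1)).factorial := by
    rw [eq_div_iff hf, h1]
  have h3' : ((2 * j + 2 * t + 1).factorial : ℝ) = 
      4 ^ (j + t + 1) * (j + t).factorial * (poch (1 / 2) t * poch (1 / 2 + t) (j + 1)) / 2 := by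
    push_cast at h3
    have : ((j : ℝ) + t + 1) * ((2 * j + 2 * t + 1).factorial * 2) = ((j : ℝ) + t + 1) *
      (4 ^ (j + t + 1) * (j + t).factorial * (poch (1 / 2) t * poch (1 / 2 + t) (j + 1))) := by
      linear_combination h3
    have := mul_left_cancel₀ hjt this
    linarith
  rw [show 2 * (j + 1) = 2 * j + 2 by ring] at h2
  push_cast at hg
  rw [show ((j + 1 : ℕ) : ℝ) + ((t : ℝ) - s) = (j : ℝ) + t + 1 - s by push_cast; ring]
  rw [div_eq_mul_inv, mul_inv, mul_inv, hg, h1', h2, h3']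
  field_simp
  ring

/-- statement (e1) of Lemma ff2: for `s ≥ 0`, `t ≥ 0`, `ω' ≥ 2t+s`
there are polynomials `Q_0, …, Q_s` with
`Σ_{j=0}^{ω'} (-1)^j (2j+2t+1)! z^{j+1}/((ω'-j)!(j+t-s)!(2j+2)!)
   = (2t)!(t-s)_s/(2(ω'+1)! t!) + Σ_{k=0}^s Q_k(z) G_k(z)`,
`G_k` the terminating hypergeometric sum `₂F₁(-1-ω'+k, 1/2+t+k; 1/2+k; z)`;
`1/(j+t-s)! = 1/Γ(j+t-s+1)` vanishes for `j+t-s < 0`. -/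
theorem lemma_ff2_e1 (s t ω' : ℕ) (hω : 2 * t + s ≤ ω') :
    ∃ Q : ℕ → Polynomial ℝ, ∀ z : ℝ,
      ∑ j ∈ range (ω' + 1),
        ((-1 : ℝ) ^ j * (Nat.factorial (2 * j + 2 * t + 1) : ℝ) * z ^ (j + 1) /
          ((Nat.factorial (ω' - j) : ℝ) *
            Real.Gamma ((j : ℝ) + (t : ℝ) - (s : ℝ) + 1) * Nat.factorial (2 * j + 2))) =
      (Nat.factorial (2 * t) : ℝ) * poch ((t : ℝ) - (s : ℝ)) s /
          (2 * Nat.factorial (ω' + 1) * Nat.factorial t) +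
        ∑ k ∈ range (s + 1), (Q k).eval z *
          ∑ m ∈ range (ω' + 1 - k + 1),
            poch ((k : ℝ) - 1 - (ω' : ℝ)) m * poch (1 / 2 + (t : ℝ) + (k : ℝ)) m /
              poch (1 / 2 + (k : ℝ)) m * z ^ m / Nat.factorial m := by
  obtain ⟨p, hp⟩ := poch_desc ((t : ℝ) - s) s
  set N := ω' + 1 with hN
  set C : ℝ := -(1 / 2) * 4 ^ t * poch (1 / 2) t / N.factorial with hC
  refine ⟨fun k => Polynomial.C (C * p k *
    (poch (-(N : ℝ)) k * poch (1 / 2 + (t : ℝ)) k / poch (1 / 2) k)) * Polynomial.X ^ k,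
    fun z => ?_⟩
  have key : ∑ m ∈ range (N + 1), C * (poch (-(N : ℝ)) m * poch (1 / 2 + (t : ℝ)) m /
      poch (1 / 2) m * z ^ m / (m.factorial : ℝ) * poch ((m : ℝ) + ((t : ℝ) - s)) s) =
      ∑ k ∈ range (s + 1), C * p k * ∑ m ∈ range (N + 1), poch (-(N : ℝ)) m *
        poch (1 / 2 + (t : ℝ)) m / poch (1 / 2) m * z ^ m / (m.factorial : ℝ) *
        (m.descFactorial k : ℝ) := by
    simp only [hp, Finset.mul_sum]
    rw [Finset.sum_comm]
    refine Finset.sum_congr rfl fun k _ => Finset.sum_congr rfl fun m _ => ?_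
    ring
  rw [Finset.sum_range_succ'] at key
  have hL : ∀ j ∈ range N, _ := fun j hj =>
    coef_eq s t N j z (by rw [Finset.mem_range] at hj; omega)
  rw [← hC] at hL
  rw [← Finset.sum_congr rfl hL] at key
  have h0 : C * (poch (-(N : ℝ)) 0 * poch (1 / 2 + (t : ℝ)) 0 /
      poch (1 / 2) 0 * z ^ 0 / (Nat.factorial 0 : ℝ) * poch (((0 : ℕ) : ℝ) + ((t : ℝ) - s)) s) =
      -((Nat.factorial (2 * t) : ℝ) * poch ((t : ℝ) - (s : ℝ)) s /
          (2 * Nat.factorial N * Nat.factorial t)) := by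
    rw [fact_two, hC]
    simp only [poch, Finset.prod_range_zero]
    have : (t.factorial : ℝ) ≠ 0 := by positivity
    have : (N.factorial : ℝ) ≠ 0 := by positivity
    simp
    field_simp
  rw [h0] at key
  have hsum : ∀ j, ω' - j = N - (j + 1) := fun j => by omega
  simp only [hsum]
  rw [← sub_eq_iff_eq_add', sub_eq_add_neg, key]
  refine Finset.sum_congr rfl fun k hk => ?_
  rw [Finset.mem_range] at hk
  rw [hyp_shift _ _ _ _ (by norm_num) N k (by omega)]
  have e : (k : ℝ) - 1 - ω' = -(N : ℝ) + k := by rw [hN]; push_cast; ring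
  rw [e]
  simp only [Polynomial.eval_mul, Polynomial.eval_C, Polynomial.eval_pow, Polynomial.eval_X]
  ring
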